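/- arXiv:1503.03147 — 8 statements merged into one kernel-verified Lean document; each statement's English description precedes it below -/
import Mathlib

section
/- Every d-pre-Cauchy net in X has a d-Cauchy subnet. -/
open scoped ENNReal

universe u v

/-- liminf of a `[0,∞]`-valued net indexed by a set with relation `r`. -/
noncomputable def netLiminf {ι : Type v} (r : ι → ι → Prop) (f : ι → ℝ≥0∞) : ℝ≥0∞ :=
  ⨆ γ : ι, ⨅ l : ι, ⨅ _ : r γ l, f l

/-- limsup of a `[0,∞]`-valued net indexed by a set with relation `r`. -/
noncomputable def netLimsup {ι : Type v} (r : ι → ι → Prop) (f : ι → ℝ≥0∞) : ℝ≥0∞ :=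
  ⨅ γ : ι, ⨆ l : ι, ⨆ _ : r γ l, f l

/-- `lim f = L` : both liminf and limsup equal `L`. -/
def NetLimEq {ι : Type v} (r : ι → ι → Prop) (f : ι → ℝ≥0∞) (L : ℝ≥0∞) : Prop :=
  netLiminf r f = L ∧ netLimsup r f = L

/-- `d` satisfies the triangle inequality. -/
def IsDistance {X : Type u} (d : X → X → ℝ≥0∞) : Prop :=
  ∀ x y z, d x z ≤ d x y + d y z

/-- the index relation is transitive and directed. -/
def DirectedIndex {ι : Type v} (r : ι → ι → Prop) : Prop :=
  (∀ a b c : ι, r a b → r b c → r a c) ∧ (∀ a b : ι, ∃ c, r a c ∧ r b c)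

/-- `d`-Cauchy net. -/
def IsCauchyNet {X : Type u} {ι : Type v} (d : X → X → ℝ≥0∞) (r : ι → ι → Prop)
    (x : ι → X) : Prop :=
  ∀ ε : ℝ≥0∞, 0 < ε → ∃ α, ∀ γ δ, r α γ → r γ δ → d (x γ) (x δ) < ε

/-- `d`-pre-Cauchy net. -/
def IsPreCauchyNet {X : Type u} {ι : Type v} (d : X → X → ℝ≥0∞) (r : ι → ι → Prop)
    (x : ι → X) : Prop :=
  ∀ ε : ℝ≥0∞, 0 < ε → ∃ α, ∀ γ, r α γ → ∃ β, ∀ δ, r β δ → d (x γ) (x δ) < ε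

/-- `d`-reflexive net. -/
def IsReflexiveNet {X : Type u} {ι : Type v} (d : X → X → ℝ≥0∞) (r : ι → ι → Prop)
    (x : ι → X) : Prop :=
  ∀ ε : ℝ≥0∞, 0 < ε → ∃ α, ∀ γ, r α γ → ∀ β, ∃ δ, r β δ ∧ d (x γ) (x δ) < ε

/-- `x` is a `d`-supremum of `Y`. -/
def IsDSup {X : Type u} (d : X → X → ℝ≥0∞) (Y : Set X) (x : X) : Prop :=
  (∀ y ∈ Y, d y x = 0) ∧ ∀ z, d x z = ⨆ y ∈ Y, d y z

/-- `x` is a `≤ᵈ`-supremum of `Y`. -/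
def IsLeDSup {X : Type u} (d : X → X → ℝ≥0∞) (Y : Set X) (x : X) : Prop :=
  (∀ y ∈ Y, d y x = 0) ∧ ∀ z, (∀ y ∈ Y, d y z = 0) → d x z = 0

/-- `Y` is `d`-directed. -/
def DDirected {X : Type u} (d : X → X → ℝ≥0∞) (Y : Set X) : Prop :=
  ∀ F : Finset X, ↑F ⊆ Y → ∀ ε : ℝ≥0∞, 0 < ε → ∃ y ∈ Y, ∀ z ∈ F, d z y < ε

/-- `Y` is `≤ᵈ`-directed (directed sets are nonempty). -/
def LeDDirected {X : Type u} (d : X → X → ℝ≥0∞) (Y : Set X) : Prop :=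
  Y.Nonempty ∧ ∀ y₁ ∈ Y, ∀ y₂ ∈ Y, ∃ y ∈ Y, d y₁ y = 0 ∧ d y₂ y = 0

/-- `X` is `f`-complete: every `f`-Cauchy net has an `X°°`-limit w.r.t. `f`. -/
def IsYonedaComplete {X : Type u} (f : X → X → ℝ≥0∞) : Prop :=
  ∀ (ι : Type u) (r : ι → ι → Prop) (x : ι → X), Nonempty ι → DirectedIndex r →
    IsCauchyNet f r x →
    ∃ z : X, (∀ c, f z c ≤ netLiminf r fun l => f (x l) c) ∧
             (∀ c, f c z ≤ netLiminf r fun l => f c (x l))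

/-- `d^•(s) = sup_x inf { d(x,y) : y ≤ᵈ x^•_s }`. -/
noncomputable def dBulletUpper {X : Type u} (d : X → X → ℝ≥0∞) (s : ℝ≥0∞) : ℝ≥0∞ :=
  ⨆ x : X, ⨅ y : X, ⨅ _ : ∀ z, d x z < s → d y z = 0, d x y

/-- `d_•(s) = sup_x inf { d(y,x) : x^s_• ≤ᵈ y }`. -/
noncomputable def dBulletLower {X : Type u} (d : X → X → ℝ≥0∞) (s : ℝ≥0∞) : ℝ≥0∞ :=
  ⨆ x : X, ⨅ y : X, ⨅ _ : ∀ z, d z x < s → d z y = 0, d y x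

/-- `d_F(s)`. -/
noncomputable def dFin {X : Type u} (d : X → X → ℝ≥0∞) (s : ℝ≥0∞) : ℝ≥0∞ :=
  ⨆ x : X, ⨆ F : Finset X, ⨆ _ : ∀ z ∈ F, d z x < s,
    ⨅ y : X, ⨅ _ : ∀ z ∈ F, d z y = 0, d y x

/-- `d_Φ(s)`. -/
noncomputable def dPhi {X : Type u} (d : X → X → ℝ≥0∞) (s : ℝ≥0∞) : ℝ≥0∞ :=
  ⨆ x : X, ⨆ F : Finset X, ⨆ _ : ∀ z ∈ F, d z x < s, ⨆ ε : ℝ≥0∞, ⨆ _ : 0 < ε,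
    ⨅ y : X, ⨅ _ : ∀ z ∈ F, d z y < ε, d y x

/-- `e∘Φᵈ(x,y) = sup_{ε>0} inf { e(x,z) : d(z,y) < ε }`. -/
noncomputable def ePhiD {X : Type u} (e d : X → X → ℝ≥0∞) (x y : X) : ℝ≥0∞ :=
  ⨆ ε : ℝ≥0∞, ⨆ _ : 0 < ε, ⨅ z : X, ⨅ _ : d z y < ε, e x z

/-- `f ⪅ g` : uniform subequivalence. -/
def SubEquiv {X : Type u} (f g : X → X → ℝ≥0∞) : Prop :=
  ∀ ε : ℝ≥0∞, 0 < ε → ∃ δ : ℝ≥0∞, 0 < δ ∧ ∀ x y, g x y ≤ δ → f x y ≤ ε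

/-- In a nonempty directed index set, finite sets have upper bounds. -/
theorem DirectedIndex.exists_finset_bound {ι : Type v} [Nonempty ι] {r : ι → ι → Prop}
    (hr : DirectedIndex r) (T : Finset ι) : ∃ u, ∀ t ∈ T, r t u := by
  classical
  induction T using Finset.induction_on with
  | empty => exact ⟨Classical.arbitrary ι, by simp⟩
  | insert a T _ ih =>
    obtain ⟨u, hu⟩ := ih
    obtain ⟨c, hac, huc⟩ := hr.2 a u
    refine ⟨c, fun t ht => ?_⟩
    rcases Finset.mem_insert.1 ht with rfl | ht
    · exact hac
    · exact hr.1 _ _ _ (hu t ht) huc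

/-- Strict inclusion of finite subsets of an infinite type is a directed index relation. -/
theorem directedIndex_finset_ssubset (κ : Type v) [Infinite κ] :
    DirectedIndex (fun F G : Finset κ => F ⊂ G) := by
  classical
  refine ⟨fun _ _ _ h₁ h₂ => h₁.trans h₂, fun F G => ?_⟩
  obtain ⟨k, hk⟩ := Infinite.exists_notMem_finset (F ∪ G)
  have h : F ∪ G ⊂ insert k (F ∪ G) := Finset.ssubset_insert hk
  exact ⟨_, Finset.subset_union_left.trans_ssubset h, Finset.subset_union_right.trans_ssubset h⟩

/-- A choice of indices along finite sets, dominating prescribed indices `p F` and indices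
`b G i` depending on the indices `i` chosen at strictly smaller sets `G`. -/
theorem DirectedIndex.exists_finset_recursion {ι : Type v} [Nonempty ι] {r : ι → ι → Prop}
    (hr : DirectedIndex r) {κ : Type v} (p : Finset κ → Finset ι) (b : Finset κ → ι → ι) :
    ∃ φ : Finset κ → ι, (∀ F, ∀ i ∈ p F, r i (φ F)) ∧ ∀ G F, G ⊂ F → r (b G (φ G)) (φ F) := by
  classical
  choose ub hub using hr.exists_finset_bound
  let step : ∀ F : Finset κ, (∀ G, G ⊂ F → ι) → ι := fun F ih =>
    ub (p F ∪ F.ssubsets.attach.image fun G => b G.1 (ih G.1 (Finset.mem_ssubsets.1 G.2)))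
  let φ : Finset κ → ι := Finset.strongInduction step
  have hφ (F) : φ F = step F fun G _ => φ G := Finset.strongInduction_eq step F
  refine ⟨φ, fun F i hi => ?_, fun G F hGF => ?_⟩
  · rw [hφ F]
    exact hub _ _ (Finset.mem_union_left _ hi)
  · rw [hφ F]
    exact hub _ _ (Finset.mem_union_right _ (Finset.mem_image.2
      ⟨⟨G, Finset.mem_ssubsets.2 hGF⟩, Finset.mem_attach _ _, rfl⟩))

/-- Every d-pre-Cauchy net in X has a d-Cauchy subnet. -/
theorem preCauchy_has_cauchy_subnet {X : Type u} {ι : Type v}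
    (d : X → X → ℝ≥0∞) (hd : IsDistance d)
    (r : ι → ι → Prop) (hne : Nonempty ι) (hr : DirectedIndex r)
    (x : ι → X) (hx : IsPreCauchyNet d r x) :
    ∃ (M : Type v) (s : M → M → Prop) (φ : M → ι),
      Nonempty M ∧ DirectedIndex s ∧
      (∀ α : ι, ∃ β : M, ∀ m : M, s β m → r α (φ m)) ∧
      IsCauchyNet d s (fun m => x (φ m)) := by
  classical
  have hpos (n : ℕ) : (0 : ℝ≥0∞) < (n : ℝ≥0∞)⁻¹ := by simp
  choose a ha using fun n : ℕ => hx _ (hpos n)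
  have hb (n : ℕ) (γ : ι) :
      ∃ β, r (a n) γ → ∀ δ, r β δ → d (x γ) (x δ) < (n : ℝ≥0∞)⁻¹ := by
    by_cases h : r (a n) γ
    · obtain ⟨β, hβ⟩ := ha n γ h
      exact ⟨β, fun _ => hβ⟩
    · exact ⟨γ, fun h' => absurd h' h⟩
  choose b hb using hb
  obtain ⟨φ, hφp, hφb⟩ := hr.exists_finset_recursion
    (fun F : Finset (ι × ℕ) => insert (a F.card) (F.image Prod.fst)) fun G => b G.card
  refine ⟨Finset (ι × ℕ), (· ⊂ ·), φ, inferInstance, directedIndex_finset_ssubset _,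
    fun α => ⟨{(α, 0)}, fun F hF => hφp F α ?_⟩, fun ε hε => ?_⟩
  · exact Finset.mem_insert_of_mem
      (Finset.mem_image.2 ⟨(α, 0), hF.subset (Finset.mem_singleton_self _), rfl⟩)
  · obtain ⟨n, hn⟩ := ENNReal.exists_inv_nat_lt hε.ne'
    obtain ⟨A, hA⟩ := Infinite.exists_subset_card_eq (ι × ℕ) n
    refine ⟨A, fun G F hAG hGF => ?_⟩
    have hcard : n ≤ G.card := hA ▸ Finset.card_le_card hAG.subset
    calc d (x (φ G)) (x (φ F)) < (G.card : ℝ≥0∞)⁻¹ :=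
          hb _ _ (hφp G _ (Finset.mem_insert_self _ _)) _ (hφb G F hGF)
      _ ≤ (n : ℝ≥0∞)⁻¹ := ENNReal.inv_le_inv.2 (by exact_mod_cast hcard)
      _ < ε := hn
end

section
/- Let (x_λ) be a d-reflexive net in X and x ∈ X. Then liminf_λ d(c,x_λ) ≥ d(c,x) holds for all c ∈ X if and only if lim_λ d(x_λ,x) = 0. -/
open scoped ENNReal

universe u v

theorem netLiminf_le_netLimsup {ι : Type v} {r : ι → ι → Prop} (hr : DirectedIndex r)
    (f : ι → ℝ≥0∞) : netLiminf r f ≤ netLimsup r f := by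
  refine iSup_le fun γ => le_iInf fun δ => ?_
  obtain ⟨l, hγ, hδ⟩ := hr.2 γ δ
  exact (iInf₂_le l hγ).trans (le_iSup₂ (f := fun l _ => f l) l hδ)

theorem netLiminf_le_of_frequently_le {ι : Type v} {r : ι → ι → Prop} {f : ι → ℝ≥0∞}
    {a : ℝ≥0∞} (h : ∀ β, ∃ δ, r β δ ∧ f δ ≤ a) : netLiminf r f ≤ a := by
  refine iSup_le fun β => ?_
  obtain ⟨δ, hβ, hδ⟩ := h β
  exact (iInf₂_le δ hβ).trans hδ

theorem netLimEq_zero_iff {ι : Type v} {r : ι → ι → Prop} (hr : DirectedIndex r)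
    (f : ι → ℝ≥0∞) :
    NetLimEq r f 0 ↔ ∀ ε : ℝ≥0∞, 0 < ε → ∃ α, ∀ γ, r α γ → f γ ≤ ε := by
  constructor
  · rintro ⟨-, h⟩ ε hε
    obtain ⟨α, hα⟩ := iInf_lt_iff.1 (h.trans_lt hε)
    exact ⟨α, fun γ hγ => (le_iSup₂ (f := fun l _ => f l) γ hγ).trans hα.le⟩
  · intro h
    have h_limsup : netLimsup r f ≤ 0 := le_of_forall_gt_imp_ge_of_dense fun ε hε => by
      obtain ⟨α, hα⟩ := h ε hε
      exact (iInf_le _ α).trans (iSup₂_le hα)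
    exact ⟨le_zero_iff.1 ((netLiminf_le_netLimsup hr f).trans h_limsup), le_zero_iff.1 h_limsup⟩

/-- For a d-reflexive net, `x` is a lower-hole limit iff `d(x_λ, x) → 0`. -/
theorem lowerHole_limit_iff {X : Type u} {ι : Type v}
    (d : X → X → ℝ≥0∞) (hd : IsDistance d)
    (r : ι → ι → Prop) (hne : Nonempty ι) (hr : DirectedIndex r)
    (x : ι → X) (hx : IsReflexiveNet d r x) (x₀ : X) :
    (∀ c : X, d c x₀ ≤ netLiminf r fun l => d c (x l)) ↔
      NetLimEq r (fun l => d (x l) x₀) 0 := by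
  rw [netLimEq_zero_iff hr]
  constructor
  · intro h ε hε
    obtain ⟨α, hα⟩ := hx ε hε
    refine ⟨α, fun γ hγ => (h (x γ)).trans (netLiminf_le_of_frequently_le fun β => ?_)⟩
    obtain ⟨δ, hβ, hδ⟩ := hα γ hγ β
    exact ⟨δ, hβ, hδ.le⟩
  · intro h c
    refine ENNReal.le_of_forall_pos_le_add fun ε hε _ => ?_
    obtain ⟨α, hα⟩ := h ε (ENNReal.coe_pos.2 hε)
    rw [← tsub_le_iff_right]
    refine le_iSup_of_le α (le_iInf₂ fun l hl => tsub_le_iff_right.2 ?_)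
    exact (hd c (x l) x₀).trans (by gcongr; exact hα l hl)
end

section
/- Suppose d_•(r) ≤ r for all r ∈ [0,∞], where d_•(r) = sup_{x∈X} inf { d(y,x) : y ∈ X such that d(z,y) = 0 for every z with d(z,x) < r }. Then for every Y ⊆ X, every ≤^d-supremum of Y is a d-supremum of Y. -/
open scoped ENNReal

universe u v

/-- If `d_• ≤ I` then `≤ᵈ`-supremums are `d`-supremums. -/
theorem leDSup_isDSup {X : Type u}
    (d : X → X → ℝ≥0∞) (hd : IsDistance d)
    (hb : ∀ s : ℝ≥0∞, dBulletLower d s ≤ s) :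
    ∀ (Y : Set X) (x : X), IsLeDSup d Y x → IsDSup d Y x := by
  intro Y x ⟨hYx, hmin⟩
  refine ⟨hYx, fun z => le_antisymm (le_of_forall_gt fun t ht => ?_) (iSup₂_le fun y hy => ?_)⟩
  · obtain ⟨s, hs, hst⟩ := exists_between ht
    refine lt_of_le_of_lt ?_ hst
    calc d x z ≤ ⨅ w : X, ⨅ _ : ∀ y, d y z < s → d y w = 0, d w z :=
          le_iInf₂ fun w hw => by
            have hxw : d x w = 0 :=
              hmin w fun y hy => hw y ((le_iSup₂ (f := fun y _ => d y z) y hy).trans_lt hs)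
            simpa [hxw] using hd x w z
      _ ≤ dBulletLower d s :=
          le_iSup (fun z => ⨅ w : X, ⨅ _ : ∀ y, d y z < s → d y w = 0, d w z) z
      _ ≤ s := hb s
  · simpa [hYx y hy] using hd y x z
end

section
/- Let Y ⊆ X, let (x_λ) be a net with x_λ ∈ Y for all λ and lim_λ d(y,x_λ) = 0 for all y ∈ Y, and let x ∈ X. Then: (i) liminf_λ d(c,x_λ) ≥ d(c,x) holds for all c ∈ X if and only if d(y,x) = 0 for all y ∈ Y; (ii) liminf_λ d(x_λ,c) ≥ d(x,c) holds for all c ∈ X if and only if d(x,z) ≤ sup_{y∈Y} d(y,z) for all z ∈ X; (iii) x is an X°°-limit of (x_λ) if and only if x is a d-supremum of Y. -/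
open scoped ENNReal

universe u v

theorem netLiminf_le_of_forall_le {ι : Type v} {r : ι → ι → Prop} (hr : DirectedIndex r)
    {f : ι → ℝ≥0∞} {a : ℝ≥0∞} (h : ∀ l, f l ≤ a) : netLiminf r f ≤ a := by
  refine iSup_le fun γ => ?_
  obtain ⟨l, hl, -⟩ := hr.2 γ γ
  exact (iInf₂_le l hl).trans (h l)

theorem le_netLiminf_of_forall_le {ι : Type v} {r : ι → ι → Prop} [Nonempty ι]
    {f : ι → ℝ≥0∞} {a : ℝ≥0∞} (h : ∀ l, a ≤ f l) : a ≤ netLiminf r f :=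
  le_iSup_of_le (Classical.arbitrary ι) (le_iInf₂ fun l _ => h l)

/-- A net that is cofinal for `y` dominates `y` in the limit. -/
theorem IsDistance.le_netLiminf {X : Type u} {ι : Type v} {d : X → X → ℝ≥0∞}
    (hd : IsDistance d) {r : ι → ι → Prop} {x : ι → X} {y : X}
    (hy : netLimsup r (fun l => d y (x l)) = 0) (c : X) :
    d y c ≤ netLiminf r fun l => d (x l) c := by
  refine ENNReal.le_of_forall_pos_le_add fun ε hε _ => ?_
  have hlt : netLimsup r (fun l => d y (x l)) < (ε : ℝ≥0∞) := by
    rw [hy]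
    exact_mod_cast hε
  obtain ⟨γ, hγ⟩ := iInf_lt_iff.1 hlt
  rw [← tsub_le_iff_right]
  refine le_iSup_of_le γ (le_iInf₂ fun l hl => ?_)
  rw [tsub_le_iff_left]
  exact (hd y (x l) c).trans (add_le_add_left
    ((le_iSup₂ (f := fun l (_ : r γ l) => d y (x l)) l hl).trans hγ.le) _)

theorem IsDistance.netLiminf_eq_iSup {X : Type u} {ι : Type v} {d : X → X → ℝ≥0∞}
    (hd : IsDistance d) {r : ι → ι → Prop} (hr : DirectedIndex r) {Y : Set X} {x : ι → X}
    (hxY : ∀ l, x l ∈ Y) (hlim : ∀ y ∈ Y, NetLimEq r (fun l => d y (x l)) 0) (c : X) :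
    (netLiminf r fun l => d (x l) c) = ⨆ y ∈ Y, d y c :=
  le_antisymm
    (netLiminf_le_of_forall_le hr fun l => le_iSup₂ (f := fun y (_ : y ∈ Y) => d y c) _ (hxY l))
    (iSup₂_le fun y hy => hd.le_netLiminf (hlim y hy).2 c)

/-- For `Y ≤ᵈ (x_λ) ⊆ Y`: lower-hole limits are upper bounds, upper-hole limits
dominate no more than `Y` does, and `X°°`-limits are exactly `d`-supremums of `Y`. -/
theorem limits_of_cofinal_net {X : Type u} {ι : Type v}
    (d : X → X → ℝ≥0∞) (hd : IsDistance d)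
    (r : ι → ι → Prop) (hne : Nonempty ι) (hr : DirectedIndex r)
    (Y : Set X) (x : ι → X) (hxY : ∀ l, x l ∈ Y)
    (hlim : ∀ y ∈ Y, NetLimEq r (fun l => d y (x l)) 0) (x₀ : X) :
    ((∀ c : X, d c x₀ ≤ netLiminf r fun l => d c (x l)) ↔ ∀ y ∈ Y, d y x₀ = 0) ∧
    ((∀ c : X, d x₀ c ≤ netLiminf r fun l => d (x l) c) ↔
      ∀ z : X, d x₀ z ≤ ⨆ y ∈ Y, d y z) ∧
    (((∀ c : X, d x₀ c ≤ netLiminf r fun l => d (x l) c) ∧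
      (∀ c : X, d c x₀ ≤ netLiminf r fun l => d c (x l))) ↔ IsDSup d Y x₀) := by
  have lower : (∀ c : X, d c x₀ ≤ netLiminf r fun l => d c (x l)) ↔ ∀ y ∈ Y, d y x₀ = 0 := by
    refine ⟨fun h y hy => ?_, fun h c => le_netLiminf_of_forall_le fun l => ?_⟩
    · simpa [(hlim y hy).1] using h y
    · simpa [h _ (hxY l)] using hd c (x l) x₀
  simp only [hd.netLiminf_eq_iSup hr hxY hlim]
  refine ⟨lower, trivial, ?_⟩
  rw [lower, and_comm]
  refine and_congr_right fun h => forall_congr' fun z => ⟨fun hz => hz.antisymm ?_, fun hz => hz.le⟩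
  exact iSup₂_le fun y hy => by simpa [h y hy] using hd y x₀ z
end

section
/- If X is d-complete, then X is d-d-complete; that is, if every d-Cauchy net in X has an X°°-limit, then every d-directed subset of X has a d-supremum. -/
open scoped ENNReal

universe u v

/-- Formal balls `(y, r)` with centre in `Y` and radius `0 < r < ∞`. -/
abbrev FormalBall {X : Type u} (Y : Set X) : Type u :=
  {p : X × ℝ≥0∞ // p.1 ∈ Y ∧ 0 < p.2 ∧ p.2 ≠ ⊤}

/-- `q` lies strictly inside `p`. -/
def FormalBall.Inside {X : Type u} (d : X → X → ℝ≥0∞) {Y : Set X} (p q : FormalBall Y) : Prop :=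
  d p.1.1 q.1.1 + q.1.2 < p.1.2

theorem FormalBall.directedIndex_inside {X : Type u} {d : X → X → ℝ≥0∞} (hd : IsDistance d)
    {Y : Set X} (hY : DDirected d Y) : DirectedIndex (FormalBall.Inside d (Y := Y)) := by
  classical
  refine ⟨fun a b c hab hbc => ?_, fun a b => ?_⟩
  · calc d a.1.1 c.1.1 + c.1.2 ≤ (d a.1.1 b.1.1 + d b.1.1 c.1.1) + c.1.2 := by
          gcongr
          exact hd _ _ _
      _ = d a.1.1 b.1.1 + (d b.1.1 c.1.1 + c.1.2) := add_assoc _ _ _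
      _ ≤ d a.1.1 b.1.1 + b.1.2 := by gcongr; exact hbc.le
      _ < a.1.2 := hab
  · obtain ⟨⟨x, r⟩, hx, hr, hr'⟩ := a
    obtain ⟨⟨y, s⟩, hy, hs, hs'⟩ := b
    have hm : 0 < min r s / 2 := ENNReal.half_pos (lt_min hr hs).ne'
    have hm' : min r s / 2 ≠ ⊤ :=
      ne_top_of_le_ne_top hr' (ENNReal.half_le_self.trans (min_le_left r s))
    obtain ⟨z, hz, h⟩ := hY {x, y} (by simp [Set.insert_subset_iff, hx, hy]) _ hm
    have key : ∀ w ∈ ({x, y} : Finset X), d w z + min r s / 2 < min r s := fun w hw =>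
      (ENNReal.add_lt_add_right hm' (h w hw)).trans_eq (ENNReal.add_halves _)
    exact ⟨⟨(z, min r s / 2), hz, hm, hm'⟩, (key x (by simp)).trans_le (min_le_left r s),
      (key y (by simp)).trans_le (min_le_right r s)⟩

theorem FormalBall.isCauchyNet_center {X : Type u} (d : X → X → ℝ≥0∞) {Y : Set X}
    (hY : Y.Nonempty) :
    IsCauchyNet d (FormalBall.Inside d (Y := Y)) fun p => p.1.1 := by
  obtain ⟨y, hy⟩ := hY
  intro ε hε
  refine ⟨⟨(y, min ε 1), hy, lt_min hε one_pos,
    ne_top_of_le_ne_top ENNReal.one_ne_top (min_le_right ε 1)⟩, fun p q hp hq => ?_⟩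
  calc d p.1.1 q.1.1 ≤ d p.1.1 q.1.1 + q.1.2 := le_self_add
    _ < p.1.2 := hq
    _ ≤ d y p.1.1 + p.1.2 := le_add_self
    _ < min ε 1 := hp
    _ ≤ ε := min_le_left ε 1

/-- If `X` is d-complete then `X` is d-d-complete. -/
theorem complete_to_ddcomplete {X : Type u}
    (d : X → X → ℝ≥0∞) (hd : IsDistance d)
    (hc : IsYonedaComplete d) :
    ∀ Y : Set X, DDirected d Y → ∃ x : X, IsDSup d Y x := by
  intro Y hY
  have hne : Y.Nonempty := by
    obtain ⟨y, hy, -⟩ := hY ∅ (by simp) 1 one_pos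
    exact ⟨y, hy⟩
  have hdir := FormalBall.directedIndex_inside hd hY
  obtain ⟨x, hx, hx'⟩ := hc (FormalBall Y) (FormalBall.Inside d) (fun p => p.1.1)
    ⟨⟨(hne.some, 1), hne.some_mem, one_pos, ENNReal.one_ne_top⟩⟩ hdir
    (FormalBall.isCauchyNet_center d hne)
  have hzero : ∀ y ∈ Y, d y x = 0 := by
    intro y hy
    refine nonpos_iff_eq_zero.mp ((hx' y).trans (iSup_le fun p => ?_))
    refine le_of_forall_pos_le_add fun ε hε => ?_
    obtain ⟨q, hpq, hyq⟩ := hdir.2 p ⟨(y, min ε 1), hy, lt_min hε one_pos,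
      ne_top_of_le_ne_top ENNReal.one_ne_top (min_le_right ε 1)⟩
    rw [zero_add]
    exact (iInf₂_le q hpq).trans (le_self_add.trans (hyq.le.trans (min_le_left ε 1)))
  refine ⟨x, hzero, fun z => le_antisymm ((hx z).trans (iSup_le fun p => ?_)) ?_⟩
  · obtain ⟨q, hpq, -⟩ := hdir.2 p p
    exact (iInf₂_le q hpq).trans (le_iSup₂ (f := fun y (_ : y ∈ Y) => d y z) q.1.1 q.2.1)
  · refine iSup₂_le fun y hy => (hd y x z).trans_eq ?_
    rw [hzero y hy, zero_add]
end

section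
/- Suppose sup_{s∈[0,r]} d^•(s) → 0 as r → 0⁺ (i.e. for every ε > 0 there is r > 0 with d^•(s) ≤ ε for all s ≤ r), where d^•(r) = sup_{x∈X} inf { d(x,y) : y ∈ X such that d(y,z) = 0 for every z with d(x,z) < r }. Then for every d-Cauchy net (x_λ) in X there is a ≤^d-directed set Y ⊆ X such that sup_{y∈Y} d(y,z) = lim_λ d(x_λ,z) and inf_{y∈Y} d(z,y) = lim_λ d(z,x_λ) for all z ∈ X. -/
open scoped ENNReal

universe u v

theorem NetLimEq.of_le_of_le {ι : Type v} {r : ι → ι → Prop} (hr : DirectedIndex r)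
    {f : ι → ℝ≥0∞} {L : ℝ≥0∞} (hsup : netLimsup r f ≤ L) (hinf : L ≤ netLiminf r f) :
    NetLimEq r f L :=
  ⟨((netLiminf_le_netLimsup hr f).trans hsup).antisymm hinf,
    hsup.antisymm (hinf.trans (netLiminf_le_netLimsup hr f))⟩

theorem le_netLiminf {ι : Type v} {r : ι → ι → Prop} {f : ι → ℝ≥0∞} {L : ℝ≥0∞} (γ : ι)
    (h : ∀ l, r γ l → L ≤ f l) : L ≤ netLiminf r f :=
  le_iSup_of_le γ (le_iInf₂ h)

theorem netLimsup_le {ι : Type v} {r : ι → ι → Prop} {f : ι → ℝ≥0∞} {L : ℝ≥0∞} (γ : ι)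
    (h : ∀ l, r γ l → f l ≤ L) : netLimsup r f ≤ L :=
  iInf_le_of_le γ (iSup₂_le h)

theorem exists_lt_of_dBulletUpper_lt {X : Type u} {d : X → X → ℝ≥0∞} {s ε : ℝ≥0∞}
    (h : dBulletUpper d s < ε) (a : X) :
    ∃ y, (∀ z, d a z < s → d y z = 0) ∧ d a y < ε := by
  have h' := (le_iSup (fun a : X => ⨅ y : X, ⨅ _ : ∀ z, d a z < s → d y z = 0, d a y) a).trans_lt h
  simpa only [iInf_lt_iff, exists_prop] using h'

/-- The points lying `≤ᵈ`-below a ball around some `x γ` whose radius is twice a bound on the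
distance from `x γ` to the rest of the net. -/
def netLowerSet {X : Type u} {ι : Type v} (d : X → X → ℝ≥0∞) (r : ι → ι → Prop)
    (x : ι → X) : Set X :=
  {y | ∃ γ s, 0 < s ∧ (∀ l, r γ l → d (x γ) (x l) < s) ∧ ∀ z, d (x γ) z < s + s → d y z = 0}

section netLowerSet

variable {X : Type u} {ι : Type v} {d : X → X → ℝ≥0∞} {r : ι → ι → Prop} {x : ι → X}

theorem exists_eq_zero_of_mem_netLowerSet {y : X} (hy : y ∈ netLowerSet d r x) :
    ∃ γ, ∀ l, r γ l → d y (x l) = 0 := by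
  obtain ⟨γ, s, -, hs, hz⟩ := hy
  exact ⟨γ, fun l hl => hz _ ((hs l hl).trans_le le_self_add)⟩

theorem IsCauchyNet.exists_mem_netLowerSet
    (hb : ∀ ε : ℝ≥0∞, 0 < ε → ∃ t : ℝ≥0∞, 0 < t ∧ ∀ s ≤ t, dBulletUpper d s ≤ ε)
    (hx : IsCauchyNet d r x) {ε : ℝ≥0∞} (hε : 0 < ε) :
    ∃ β, ∀ l, r β l → ∃ y ∈ netLowerSet d r x, d (x l) y < ε := by
  obtain ⟨ε', hε', hlt⟩ := exists_between hε
  obtain ⟨t, ht, hdt⟩ := hb ε' hε'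
  have ht2 : 0 < t / 2 := ENNReal.half_pos ht.ne'
  obtain ⟨β, hβ⟩ := hx (t / 2) ht2
  refine ⟨β, fun l hl => ?_⟩
  obtain ⟨y, hy, hly⟩ := exists_lt_of_dBulletUpper_lt ((hdt t le_rfl).trans_lt hlt) (x l)
  refine ⟨y, ⟨l, t / 2, ht2, fun m hm => hβ l m hl hm, ?_⟩, hly⟩
  rwa [ENNReal.add_halves]

theorem IsCauchyNet.leDDirected_netLowerSet (hd : IsDistance d)
    (hb : ∀ ε : ℝ≥0∞, 0 < ε → ∃ t : ℝ≥0∞, 0 < t ∧ ∀ s ≤ t, dBulletUpper d s ≤ ε)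
    (hr : DirectedIndex r) (hx : IsCauchyNet d r x) :
    LeDDirected d (netLowerSet d r x) := by
  constructor
  · obtain ⟨β, hβ⟩ := hx.exists_mem_netLowerSet hb one_pos
    obtain ⟨l, hl, -⟩ := hr.2 β β
    obtain ⟨y, hy, -⟩ := hβ l hl
    exact ⟨y, hy⟩
  · rintro y₁ ⟨γ₁, s₁, hs₁, hγ₁, hy₁⟩ y₂ ⟨γ₂, s₂, hs₂, hγ₂, hy₂⟩
    obtain ⟨β, hβ⟩ := hx.exists_mem_netLowerSet hb (lt_min hs₁ hs₂)
    obtain ⟨γ, h₁, h₂⟩ := hr.2 γ₁ γ₂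
    obtain ⟨l, hγl, hβl⟩ := hr.2 γ β
    obtain ⟨y, hy, hly⟩ := hβ l hβl
    refine ⟨y, hy, hy₁ y ?_, hy₂ y ?_⟩
    · exact (hd _ (x l) _).trans_lt (ENNReal.add_lt_add (hγ₁ l (hr.1 _ _ _ h₁ hγl))
        (hly.trans_le (min_le_left _ _)))
    · exact (hd _ (x l) _).trans_lt (ENNReal.add_lt_add (hγ₂ l (hr.1 _ _ _ h₂ hγl))
        (hly.trans_le (min_le_right _ _)))

theorem IsCauchyNet.netLimEq_iSup_netLowerSet (hd : IsDistance d)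
    (hb : ∀ ε : ℝ≥0∞, 0 < ε → ∃ t : ℝ≥0∞, 0 < t ∧ ∀ s ≤ t, dBulletUpper d s ≤ ε)
    (hr : DirectedIndex r) (hx : IsCauchyNet d r x) (z : X) :
    NetLimEq r (fun l => d (x l) z) (⨆ y ∈ netLowerSet d r x, d y z) := by
  refine .of_le_of_le hr (ENNReal.le_of_forall_pos_le_add fun ε hε _ => ?_)
    (iSup₂_le fun y hy => ?_)
  · obtain ⟨β, hβ⟩ := hx.exists_mem_netLowerSet hb (ENNReal.coe_pos.2 hε)
    refine netLimsup_le β fun l hl => ?_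
    obtain ⟨y, hy, hly⟩ := hβ l hl
    rw [add_comm]
    exact (hd _ y _).trans
      (add_le_add hly.le (le_iSup₂ (f := fun y (_ : y ∈ netLowerSet d r x) => d y z) y hy))
  · obtain ⟨γ, hγ⟩ := exists_eq_zero_of_mem_netLowerSet hy
    refine le_netLiminf γ fun l hl => ?_
    simpa only [hγ l hl, zero_add] using hd y (x l) z

theorem IsCauchyNet.netLimEq_iInf_netLowerSet (hd : IsDistance d)
    (hb : ∀ ε : ℝ≥0∞, 0 < ε → ∃ t : ℝ≥0∞, 0 < t ∧ ∀ s ≤ t, dBulletUpper d s ≤ ε)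
    (hr : DirectedIndex r) (hx : IsCauchyNet d r x) (z : X) :
    NetLimEq r (fun l => d z (x l)) (⨅ y ∈ netLowerSet d r x, d z y) := by
  refine .of_le_of_le hr (le_iInf₂ fun y hy => ?_)
    (ENNReal.le_of_forall_pos_le_add fun ε hε _ => ?_)
  · obtain ⟨γ, hγ⟩ := exists_eq_zero_of_mem_netLowerSet hy
    refine netLimsup_le γ fun l hl => ?_
    simpa only [hγ l hl, add_zero] using hd z y (x l)
  · obtain ⟨β, hβ⟩ := hx.exists_mem_netLowerSet hb (ENNReal.coe_pos.2 hε)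
    refine tsub_le_iff_right.1 (le_netLiminf β fun l hl => tsub_le_iff_right.2 ?_)
    obtain ⟨y, hy, hly⟩ := hβ l hl
    exact (iInf₂_le y hy).trans ((hd _ (x l) _).trans (by gcongr))

end netLowerSet

/-- If `d^• ⪅ I` then every d-Cauchy net admits a `≤ᵈ`-directed set `Y` with
`Yd = (x_λ)d` and `dY = d(x_λ)`. -/
theorem cauchy_to_directed {X : Type u} {ι : Type v}
    (d : X → X → ℝ≥0∞) (hd : IsDistance d)
    (hb : ∀ ε : ℝ≥0∞, 0 < ε → ∃ t : ℝ≥0∞, 0 < t ∧ ∀ s ≤ t, dBulletUpper d s ≤ ε)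
    (r : ι → ι → Prop) (hne : Nonempty ι) (hr : DirectedIndex r)
    (x : ι → X) (hx : IsCauchyNet d r x) :
    ∃ Y : Set X, LeDDirected d Y ∧
      (∀ z : X, NetLimEq r (fun l => d (x l) z) (⨆ y ∈ Y, d y z)) ∧
      (∀ z : X, NetLimEq r (fun l => d z (x l)) (⨅ y ∈ Y, d z y)) := by
  exact ⟨netLowerSet d r x, hx.leDDirected_netLowerSet hd hb hr,
    hx.netLimEq_iSup_netLowerSet hd hb hr, hx.netLimEq_iInf_netLowerSet hd hb hr⟩
end

section
/- Suppose d is a hemimetric (d(x,x) = 0 for all x ∈ X), X is d^∨-complete where d^∨(x,y) = max(d(x,y), d(y,x)), and sup_{s∈[0,r]} d_Φ(s) → 0 as r → 0⁺. Then d_F = d_Φ as functions on [0,∞], where d_F(r) = sup over x ∈ X and finite F ⊆ {y : d(y,x) < r} of inf { d(y,x) : y ∈ X such that d(z,y) = 0 for all z ∈ F }, and d_Φ(r) = sup over x ∈ X, finite F ⊆ {y : d(y,x) < r}, and ε > 0 of inf { d(y,x) : y ∈ X such that d(z,y) < ε for all z ∈ F }. -/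
open scoped ENNReal

universe u v

/-- The symmetrization `max (d x y) (d y x)` of a distance is a distance. -/
theorem IsDistance.symmetrize {X : Type u} {d : X → X → ℝ≥0∞} (hd : IsDistance d) :
    IsDistance fun x y => max (d x y) (d y x) := by
  intro x y z
  refine max_le ((hd x y z).trans (add_le_add (le_max_left _ _) (le_max_left _ _))) ?_
  refine (hd z y x).trans ?_
  rw [add_comm]
  exact add_le_add (le_max_right _ _) (le_max_right _ _)

/-- Along a sequence with steps bounded by `g`, distances are bounded by tails of `∑ g`. -/
theorem IsDistance.le_tsum_tail {X : Type u} {e : X → X → ℝ≥0∞} (he : IsDistance e)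
    (hrefl : ∀ x, e x x = 0) {g : ℕ → ℝ≥0∞} {y : ℕ → X}
    (hy : ∀ n, e (y n) (y (n + 1)) ≤ g n) {m n : ℕ} (hmn : m ≤ n) :
    e (y m) (y n) ≤ ∑' k, g (k + m) := by
  obtain ⟨k, rfl⟩ := Nat.exists_eq_add_of_le hmn
  refine le_trans ?_ (ENNReal.sum_le_tsum (Finset.range k))
  clear hmn
  induction k with
  | zero => simp [hrefl]
  | succ k ih =>
    rw [Finset.sum_range_succ]
    refine (he _ (y (m + k)) _).trans (add_le_add ih ?_)
    simpa [add_comm, add_left_comm, add_assoc] using hy (m + k)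

/-- In a complete space, a sequence with summable steps has a limit at distance controlled by
the tails of the sum. -/
theorem IsYonedaComplete.exists_limit {X : Type u} {e : X → X → ℝ≥0∞} (hc : IsYonedaComplete e)
    (he : IsDistance e) (hrefl : ∀ x, e x x = 0) {g : ℕ → ℝ≥0∞} (hg : ∑' k, g k ≠ ∞)
    {y : ℕ → X} (hy : ∀ n, e (y n) (y (n + 1)) ≤ g n) :
    ∃ z, ∀ n, e (y n) z ≤ ∑' k, g (k + n) := by
  obtain ⟨z, -, hz⟩ := hc (ULift.{u} ℕ) (fun a b => a.down ≤ b.down) (fun a => y a.down)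
    inferInstance ⟨fun _ _ _ => le_trans, fun a b => ⟨⟨max a.down b.down⟩, by simp⟩⟩ (by
      intro ε hε
      obtain ⟨N, hN⟩ := Filter.eventually_atTop.1
        ((ENNReal.tendsto_sum_nat_add g hg).eventually_lt_const hε)
      exact ⟨⟨N⟩, fun γ δ hγ hδ => (he.le_tsum_tail hrefl hy hδ).trans_lt (hN _ hγ)⟩)
  refine ⟨z, fun n => (hz (y n)).trans (iSup_le fun γ => ?_)⟩
  exact (iInf₂_le (⟨max γ.down n⟩ : ULift.{u} ℕ) (le_max_left _ _)).trans
    (he.le_tsum_tail hrefl hy (le_max_right _ _))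

theorem dPhi_le_dFin {X : Type u} (d : X → X → ℝ≥0∞) (s : ℝ≥0∞) : dPhi d s ≤ dFin d s := by
  refine iSup_le fun x => iSup_le fun F => iSup_le fun hF => iSup₂_le fun ε hε => ?_
  refine le_iSup_of_le x (le_iSup_of_le F (le_iSup_of_le hF ?_))
  exact le_iInf₂ fun y hy => iInf₂_le y fun z hz => (hy z hz).trans_lt hε

theorem exists_lt_of_dPhi_lt {X : Type u} {d : X → X → ℝ≥0∞} {s a : ℝ≥0∞} (h : dPhi d s < a)
    {x : X} {F : Finset X} (hF : ∀ z ∈ F, d z x < s) {ε : ℝ≥0∞} (hε : 0 < ε) :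
    ∃ y, (∀ z ∈ F, d z y < ε) ∧ d y x < a := by
  have hle : (⨅ y : X, ⨅ _ : ∀ z ∈ F, d z y < ε, d y x) ≤ dPhi d s :=
    le_iSup_of_le x (le_iSup_of_le F (le_iSup_of_le hF (le_iSup₂_of_le ε hε le_rfl)))
  simpa [iInf_lt_iff] using hle.trans_lt h

/-- For a hemimetric `d` on a `d^∨`-complete space with `d_Φ ⪅ I`, `d_F = d_Φ`. -/
theorem dFin_eq_dPhi {X : Type u}
    (d : X → X → ℝ≥0∞) (hd : IsDistance d)
    (hhemi : ∀ x : X, d x x = 0)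
    (hcomp : IsYonedaComplete (fun x y : X => max (d x y) (d y x)))
    (hphi : ∀ ε : ℝ≥0∞, 0 < ε → ∃ t : ℝ≥0∞, 0 < t ∧ ∀ s ≤ t, dPhi d s ≤ ε) :
    ∀ s : ℝ≥0∞, dFin d s = dPhi d s := by
  classical
  intro s
  refine le_antisymm ?_ (dPhi_le_dFin d s)
  refine iSup_le fun x => iSup_le fun F => iSup_le fun hF => le_of_forall_gt fun a ha => ?_
  obtain ⟨b, hb, hba⟩ := exists_between ha
  obtain ⟨g, hg0, hg⟩ := ENNReal.exists_pos_sum_of_countable (tsub_pos_of_lt hba).ne' ℕ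
  have hsmall : ∀ n, ∃ t : ℝ≥0∞, 0 < t ∧ t ≤ g n ∧ dPhi d t < g n := by
    intro n
    obtain ⟨c, hc, hcg⟩ := exists_between (ENNReal.coe_pos.2 (hg0 n))
    obtain ⟨t, ht, htc⟩ := hphi c hc
    exact ⟨min t (g n), lt_min ht (ENNReal.coe_pos.2 (hg0 n)), min_le_right _ _,
      (htc _ (min_le_left _ _)).trans_lt hcg⟩
  choose t ht0 htg htphi using hsmall
  obtain ⟨y₀, hy₀F, hy₀x⟩ := exists_lt_of_dPhi_lt hb hF (ht0 0)
  have step : ∀ n (w : {w : X // ∀ z ∈ F, d z w < t n}),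
      ∃ w' : {w' : X // ∀ z ∈ F, d z w' < t (n + 1)},
        max (d w.1 w'.1) (d w'.1 w.1) ≤ g n := by
    rintro n ⟨w, hw⟩
    obtain ⟨w', hw', hlt⟩ := exists_lt_of_dPhi_lt (htphi n) (F := insert w F) (x := w)
      (by simpa [hhemi, ht0] using hw) (lt_min (ht0 (n + 1)) (ENNReal.coe_pos.2 (hg0 n)))
    exact ⟨⟨w', fun z hz => (hw' z (Finset.mem_insert_of_mem hz)).trans_le (min_le_left _ _)⟩,
      max_le ((hw' w (Finset.mem_insert_self _ _)).le.trans (min_le_right _ _)) hlt.le⟩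
  choose next hnext using step
  let y : (n : ℕ) → {w : X // ∀ z ∈ F, d z w < t n} :=
    fun n => Nat.rec ⟨y₀, hy₀F⟩ next n
  have hsum : ∑' k, (g k : ℝ≥0∞) ≠ ∞ := hg.ne_top
  obtain ⟨z, hz⟩ := hcomp.exists_limit hd.symmetrize (by simp [hhemi]) hsum
    (y := fun n => (y n).1) (fun n => hnext n (y n))
  have hzF : ∀ w ∈ F, d w z = 0 := by
    intro w hw
    have hlim := (ENNReal.tendsto_atTop_zero_of_tsum_ne_top hsum).add
      (ENNReal.tendsto_sum_nat_add _ hsum)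
    rw [add_zero] at hlim
    refine le_antisymm (ge_of_tendsto' hlim fun n => ?_) zero_le
    exact (hd w (y n).1 z).trans (add_le_add (((y n).2 w hw).le.trans (htg n))
      ((le_max_left _ _).trans (hz n)))
  refine (iInf₂_le z hzF).trans_lt ((hd z y₀ x).trans_lt ?_)
  have hz0 : d z y₀ < a - b := ((le_max_right _ _).trans (hz 0)).trans_lt (by simpa using hg)
  calc d z y₀ + d y₀ x < (a - b) + b := ENNReal.add_lt_add hz0 hy₀x
    _ = a := tsub_add_cancel_of_le hba.le
end

section
/- Let e be a symmetric distance on X (e(x,y) = e(y,x) for all x,y). Suppose X is e-complete, e∘Φ^d ⪅ d, and d ⪅ e. Then e∘Φ^d = e∘≤^d; that is, for all x,y ∈ X: sup_{ε>0} inf { e(x,z) : z ∈ X, d(z,y) < ε } = inf { e(x,z) : z ∈ X, d(z,y) = 0 }. -/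
open scoped ENNReal

universe u v

theorem exists_lt_of_ePhiD_lt {X : Type u} {e d : X → X → ℝ≥0∞} {x y : X} {s ε : ℝ≥0∞}
    (h : ePhiD e d x y < s) (hε : 0 < ε) : ∃ z, d z y < ε ∧ e x z < s := by
  have h' : ⨅ z : X, ⨅ _ : d z y < ε, e x z < s :=
    (le_iSup₂ (f := fun (ε : ℝ≥0∞) (_ : 0 < ε) => ⨅ z : X, ⨅ _ : d z y < ε, e x z) ε hε).trans_lt h
  simpa only [iInf_lt_iff, exists_prop] using h'

theorem ePhiD_le_eLeD {X : Type u} (e d : X → X → ℝ≥0∞) (x y : X) :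
    ePhiD e d x y ≤ ⨅ z : X, ⨅ _ : d z y = 0, e x z :=
  iSup₂_le fun _ hε => le_iInf₂ fun z hz => iInf₂_le z (hz.trans_lt hε)

/-- In a Yoneda complete distance space, a sequence whose tails are controlled by a null sequence
`t` has a point to which it converges at the rate `t`. -/
theorem IsYonedaComplete.exists_forall_le {X : Type u} {e : X → X → ℝ≥0∞}
    (hcomp : IsYonedaComplete e) {z : ℕ → X} {t : ℕ → ℝ≥0∞}
    (ht : Filter.Tendsto t Filter.atTop (nhds 0))
    (hz : ∀ m n, m < n → e (z m) (z n) ≤ t m) : ∃ w, ∀ m, e (z m) w ≤ t m := by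
  obtain ⟨w, -, hw⟩ := hcomp (ULift.{u} ℕ) (fun a b => a.down < b.down) (fun a => z a.down)
    ⟨⟨0⟩⟩
    ⟨fun _ _ _ => lt_trans, fun a b => ⟨⟨max a.down b.down + 1⟩,
      Nat.lt_succ_of_le (le_max_left _ _), Nat.lt_succ_of_le (le_max_right _ _)⟩⟩
    (fun ε hε => by
      obtain ⟨N, hN⟩ := Filter.eventually_atTop.1 (ht.eventually_lt_const hε)
      exact ⟨⟨N⟩, fun γ δ hγ hδ => (hz _ _ hδ).trans_lt (hN _ (le_of_lt hγ))⟩)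
  refine ⟨w, fun m => (hw (z m)).trans (iSup_le fun γ => ?_)⟩
  exact (iInf₂_le (ULift.up (max γ.down m + 1)) (Nat.lt_succ_of_le (le_max_left _ _))).trans
    (hz _ _ (Nat.lt_succ_of_le (le_max_right _ _)))

theorem IsDistance.le_of_forall_add_le {X : Type u} {e : X → X → ℝ≥0∞} (he : IsDistance e)
    {z : ℕ → X} {t : ℕ → ℝ≥0∞} (hz : ∀ n, e (z n) (z (n + 1)) + t (n + 1) ≤ t n)
    (m n : ℕ) (h : m < n) : e (z m) (z n) ≤ t m := by
  suffices e (z m) (z n) + t n ≤ t m from le_self_add.trans this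
  induction n, h using Nat.le_induction with
  | base => exact hz m
  | succ n _ ih =>
    calc e (z m) (z (n + 1)) + t (n + 1)
        ≤ e (z m) (z n) + (e (z n) (z (n + 1)) + t (n + 1)) := by
          rw [← add_assoc]; gcongr; exact he _ _ _
      _ ≤ e (z m) (z n) + t n := by gcongr; exact hz n
      _ ≤ t m := ih

/-- If `e∘Φᵈ ⪅ d`, a point `d`-close to `y` from below starts a sequence that is `d`-convergent to
`y` and moves by `e`-steps as small as prescribed. -/
theorem SubEquiv.exists_seq {X : Type u} {e d : X → X → ℝ≥0∞} (h : SubEquiv (ePhiD e d) d)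
    {x y : X} {s : ℝ≥0∞} (hs : ePhiD e d x y < s) {t : ℕ → ℝ≥0∞} (ht0 : ∀ n, 0 < t n)
    (ht : ∀ n, t (n + 1) < t n) :
    ∃ z : ℕ → X, e x (z 0) < s ∧ ∀ n, d (z n) y < t n ∧ e (z n) (z (n + 1)) < t (n + 1) := by
  choose δ hδ hδe using fun n => h (t (n + 2)) (ht0 _)
  have hmin : ∀ n, 0 < min (δ n) (t n) := fun n => lt_min (hδ n) (ht0 n)
  have step : ∀ (n : ℕ) (w : X), ∃ w', d w y < min (δ n) (t n) →
      d w' y < min (δ (n + 1)) (t (n + 1)) ∧ e w w' < t (n + 1) := fun n w => by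
    by_cases hw : d w y < min (δ n) (t n)
    · obtain ⟨w', hw'⟩ := exists_lt_of_ePhiD_lt
        ((hδe n w y (hw.le.trans (min_le_left _ _))).trans_lt (ht (n + 1))) (hmin (n + 1))
      exact ⟨w', fun _ => hw'⟩
    · exact ⟨w, fun h => absurd h hw⟩
  choose g hg using step
  obtain ⟨z₀, hz₀, hxz₀⟩ := exists_lt_of_ePhiD_lt hs (hmin 0)
  let z : ℕ → X := fun n => Nat.rec z₀ g n
  have hz : ∀ n, d (z n) y < min (δ n) (t n) := fun n => by
    induction n with
    | zero => exact hz₀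
    | succ n ih => exact (hg n _ ih).1
  exact ⟨z, hxz₀, fun n => ⟨(hz n).trans_le (min_le_right _ _), (hg n _ (hz n)).2⟩⟩

/-- If `e` is a symmetric distance, `X` is `e`-complete, `e∘Φᵈ ⪅ d` and `d ⪅ e`,
then `e∘Φᵈ = e∘≤ᵈ`. -/
theorem ePhiD_eq_eLeD {X : Type u}
    (d e : X → X → ℝ≥0∞) (hd : IsDistance d) (he : IsDistance e)
    (hsym : ∀ x y : X, e x y = e y x)
    (hcomp : IsYonedaComplete e)
    (h1 : SubEquiv (ePhiD e d) d) (h2 : SubEquiv d e) :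
    ∀ x y : X, ePhiD e d x y = ⨅ z : X, ⨅ _ : d z y = 0, e x z := by
  intro x y
  refine le_antisymm (ePhiD_le_eLeD e d x y)
    (ENNReal.le_of_forall_pos_le_add fun η hη hfin => ?_)
  let t : ℕ → ℝ≥0∞ := fun n => ((η * (1 / 2) ^ (n + 1) : NNReal) : ℝ≥0∞)
  have ht0 : ∀ n, 0 < t n := fun n => ENNReal.coe_pos.2 (by positivity)
  have htadd : ∀ n, t (n + 1) + t (n + 1) = t n := fun n => by
    simp only [t, ← ENNReal.coe_add]
    congr 1
    rw [pow_succ _ (n + 1), ← mul_assoc, ← mul_add, add_halves, mul_one]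
  have htlt : ∀ n, t (n + 1) < t n := fun n => by
    rw [← htadd n]
    exact ENNReal.lt_add_right ENNReal.coe_ne_top (ht0 _).ne'
  have htlim : Filter.Tendsto t Filter.atTop (nhds 0) := by
    rw [← ENNReal.coe_zero, ENNReal.tendsto_coe, ← mul_zero η]
    refine Filter.Tendsto.const_mul η ((Filter.tendsto_add_atTop_iff_nat 1).2 ?_)
    exact tendsto_pow_atTop_nhds_zero_of_lt_one zero_le (NNReal.half_lt_self one_ne_zero)
  obtain ⟨z, hxz, hz⟩ := h1.exists_seq
    (ENNReal.lt_add_right hfin.ne (ht0 0).ne') ht0 htlt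
  obtain ⟨w, hw⟩ := hcomp.exists_forall_le htlim (he.le_of_forall_add_le fun n =>
    (add_le_add_left (hz n).2.le _).trans (htadd n).le)
  have hwy : d w y = 0 := by
    refine nonpos_iff_eq_zero.1 (ENNReal.le_of_forall_pos_le_add fun κ hκ _ => ?_)
    have hκ2 : (0 : ℝ≥0∞) < κ / 2 := ENNReal.half_pos (ENNReal.coe_pos.2 hκ).ne'
    obtain ⟨δ, hδ, hδd⟩ := h2 (κ / 2) hκ2
    obtain ⟨m, hm⟩ := (htlim.eventually_lt_const (lt_min hδ hκ2)).exists
    calc d w y ≤ d w (z m) + d (z m) y := hd _ _ _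
      _ ≤ κ / 2 + κ / 2 := add_le_add
          (hδd _ _ ((hsym _ _).trans_le ((hw m).trans (hm.le.trans (min_le_left _ _)))))
          ((hz m).1.le.trans (hm.le.trans (min_le_right _ _)))
      _ = 0 + κ := by rw [ENNReal.add_halves, zero_add]
  calc ⨅ z : X, ⨅ _ : d z y = 0, e x z ≤ e x w := iInf₂_le w hwy
    _ ≤ e x (z 0) + e (z 0) w := he _ _ _
    _ ≤ ePhiD e d x y + t 0 + t 0 := add_le_add hxz.le (hw 0)
    _ = ePhiD e d x y + η := by
      rw [add_assoc]
      congr 1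
      simp only [t, ← ENNReal.coe_add]
      rw [zero_add, pow_one, ← mul_add, add_halves, mul_one]
end
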